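/- (Proposition 3, part (ii): convergence rate of relaxed FISTA.) Under the relaxed FISTA setup with step size 0 < γ ≤ (1 − α²)/(2L) for any fixed α ∈ [0, 1), and assuming F* := inf_{x∈ℝ^N} F(x) > −∞, for every K ≥ 1: min_{k∈{1,…,K}} ‖G_γ(f_k)‖² ≤ 2L(3 + γL)²(F(f₀) − F*) / (K γ L (1 − γL)), where G_γ(x) = (x − prox_{γR}(x − γ∇D(x)))/γ. -/

import Mathlib

open scoped RealInnerProductSpace

/-- The gradient mapping `G_γ(x) = (x - prox_{γR}(x - γ∇D(x)))/γ`. -/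
noncomputable def gradMap {N : ℕ} (γ : ℝ)
    (gradD : EuclideanSpace ℝ (Fin N) → EuclideanSpace ℝ (Fin N))
    (prox : EuclideanSpace ℝ (Fin N) → EuclideanSpace ℝ (Fin N))
    (x : EuclideanSpace ℝ (Fin N)) : EuclideanSpace ℝ (Fin N) :=
  γ⁻¹ • (x - prox (x - γ • gradD x))

section Descent

variable {E : Type*} [NormedAddCommGroup E] [InnerProductSpace ℝ E] [CompleteSpace E]

/-- Descent lemma: a function with `L`-Lipschitz gradient is bounded above by its quadratic
model. -/
theorem le_quadratic_of_lipschitz_gradient {D : E → ℝ} {g : E → E} {L : ℝ}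
    (hD : ∀ x, HasGradientAt D (g x) x) (hg : ∀ x y, ‖g x - g y‖ ≤ L * ‖x - y‖) (x y : E) :
    D y ≤ D x + ⟪g x, y - x⟫ + L / 2 * ‖y - x‖ ^ 2 := by
  set v := y - x with hv
  let φ : ℝ → ℝ := fun t => D (x + t • v) - t * ⟪g x, v⟫ - L / 2 * ‖v‖ ^ 2 * t ^ 2
  have hφ (t : ℝ) :
      HasDerivAt φ (⟪g (x + t • v), v⟫ - ⟪g x, v⟫ - L / 2 * ‖v‖ ^ 2 * (2 * t)) t := by
    have hline : HasDerivAt (fun t : ℝ => x + t • v) v t := by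
      simpa using ((hasDerivAt_id t).smul_const v).const_add x
    have hcomp : HasDerivAt (fun t : ℝ => D (x + t • v)) ⟪g (x + t • v), v⟫ t := by
      have h := (hD (x + t • v)).hasFDerivAt.comp_hasDerivAt t hline
      rwa [InnerProductSpace.toDual_apply_apply] at h
    have hlin : HasDerivAt (fun t : ℝ => t * ⟪g x, v⟫) ⟪g x, v⟫ t := by
      simpa using (hasDerivAt_id t).mul_const ⟪g x, v⟫
    have hsq : HasDerivAt (fun t : ℝ => L / 2 * ‖v‖ ^ 2 * t ^ 2) (L / 2 * ‖v‖ ^ 2 * (2 * t)) t := by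
      simpa using (hasDerivAt_pow 2 t).const_mul (L / 2 * ‖v‖ ^ 2)
    exact (hcomp.sub hlin).sub hsq
  have hanti : AntitoneOn φ (Set.Icc 0 1) := by
    refine antitoneOn_of_deriv_nonpos (convex_Icc 0 1)
      (fun t _ => (hφ t).continuousAt.continuousWithinAt)
      (fun t _ => (hφ t).differentiableAt.differentiableWithinAt) fun t ht => ?_
    rw [interior_Icc] at ht
    have ht0 : 0 ≤ t := ht.1.le
    have hinner : ⟪g (x + t • v), v⟫ - ⟪g x, v⟫ ≤ L * (t * ‖v‖) * ‖v‖ := by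
      rw [← inner_sub_left]
      refine (real_inner_le_norm _ _).trans ?_
      gcongr
      simpa [norm_smul, abs_of_nonneg ht0] using hg (x + t • v) x
    rw [(hφ t).deriv]
    linarith
  have h01 := hanti (Set.left_mem_Icc.2 zero_le_one) (Set.right_mem_Icc.2 zero_le_one) zero_le_one
  have hxy : x + v = y := by simp [hv]
  simp only [φ, one_smul, zero_smul, add_zero, hxy] at h01
  linarith

theorem quadratic_le_of_lipschitz_gradient {D : E → ℝ} {g : E → E} {L : ℝ}
    (hD : ∀ x, HasGradientAt D (g x) x) (hg : ∀ x y, ‖g x - g y‖ ≤ L * ‖x - y‖) (x y : E) :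
    D x + ⟪g x, y - x⟫ - L / 2 * ‖y - x‖ ^ 2 ≤ D y := by
  have hneg (x : E) : HasGradientAt (fun z => -D z) (-g x) x := by
    rw [hasGradientAt_iff_hasFDerivAt, map_neg]
    exact (hD x).hasFDerivAt.neg
  have h := le_quadratic_of_lipschitz_gradient hneg (g := fun z => -g z) (L := L)
    (fun a b => by simpa [neg_add_eq_sub, norm_sub_rev] using hg a b) x y
  rw [inner_neg_left] at h
  linarith

end Descent

section Proximal

variable {E : Type*} [NormedAddCommGroup E]

/-- `p` minimizes `z ↦ R z + (1/(2γ))‖z - x‖²`. -/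
def IsProxPoint (R : E → EReal) (γ : ℝ) (x p : E) : Prop :=
  ∀ z, R p + ((1 / (2 * γ) * ‖p - x‖ ^ 2 : ℝ) : EReal) ≤
    R z + ((1 / (2 * γ) * ‖z - x‖ ^ 2 : ℝ) : EReal)

theorem IsProxPoint.ne_top {R : E → EReal} {γ : ℝ} {x p z : E} (hp : IsProxPoint R γ x p)
    (hz : R z ≠ ⊤) : R p ≠ ⊤ := by
  intro htop
  have h := hp z
  rw [htop, EReal.top_add_coe, top_le_iff] at h
  exact EReal.add_ne_top hz (EReal.coe_ne_top _) h

variable [InnerProductSpace ℝ E]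

/-- The first-order optimality condition `(x - p)/γ ∈ ∂R(p)` of a proximal point. -/
theorem IsProxPoint.subgradient {R : E → EReal} {γ : ℝ} {x p z : E}
    (hp : IsProxPoint R γ x p) (hγ : 0 < γ) (hRbot : ∀ x, R x ≠ ⊥)
    (hRconvex : ∀ x y : E, ∀ a b : ℝ, 0 ≤ a → 0 ≤ b → a + b = 1 →
      R (a • x + b • y) ≤ (a : EReal) * R x + (b : EReal) * R y)
    (hz : R z ≠ ⊤) : ⟪x - p, z - p⟫ ≤ γ * ((R z).toReal - (R p).toReal) := by
  have hpt := hp.ne_top hz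
  have hsegment (t : ℝ) (ht0 : 0 < t) (ht1 : t ≤ 1) :
      ⟪x - p, z - p⟫ ≤ γ * ((R z).toReal - (R p).toReal) + t * (‖z - p‖ ^ 2 / 2) := by
    have h := (hp ((1 - t) • p + t • z)).trans
      (add_le_add_left (hRconvex p z (1 - t) t (by linarith) ht0.le (by ring)) _)
    rw [← EReal.coe_toReal hz (hRbot z), ← EReal.coe_toReal hpt (hRbot p)] at h
    norm_cast at h
    have hpoint : (1 - t) • p + t • z - x = t • (z - p) - (x - p) := by module
    rw [hpoint, norm_sub_sq_real (t • (z - p)), norm_smul, inner_smul_left,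
      real_inner_comm, norm_sub_rev p x, mul_pow, Real.norm_eq_abs, sq_abs] at h
    simp only [conj_trivial] at h
    have hscaled : t * ⟪x - p, z - p⟫ ≤
        t * (γ * ((R z).toReal - (R p).toReal) + t * (‖z - p‖ ^ 2 / 2)) := by
      have h' := mul_le_mul_of_nonneg_left h hγ.le
      field_simp at h'
      linarith
    exact le_of_mul_le_mul_left hscaled ht0
  refine le_of_forall_pos_le_add fun ε hε => ?_
  set c := ‖z - p‖ ^ 2 / 2
  have hc0 : 0 ≤ c := by positivity
  have hεc : 0 < ε + c := by positivity
  refine (hsegment (ε / (ε + c)) (by positivity) ((div_le_one hεc).2 (by linarith))).trans ?_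
  gcongr
  rw [div_mul_eq_mul_div, div_le_iff₀ hεc]
  nlinarith

theorem IsProxPoint.norm_sub_le {R : E → EReal} {γ : ℝ} {x y p q : E}
    (hp : IsProxPoint R γ x p) (hq : IsProxPoint R γ y q) (hγ : 0 < γ) (hRbot : ∀ x, R x ≠ ⊥)
    (hRconvex : ∀ x y : E, ∀ a b : ℝ, 0 ≤ a → 0 ≤ b → a + b = 1 →
      R (a • x + b • y) ≤ (a : EReal) * R x + (b : EReal) * R y)
    (hproper : ∃ z, R z ≠ ⊤) : ‖p - q‖ ≤ ‖x - y‖ := by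
  obtain ⟨z, hz⟩ := hproper
  have h₁ := hp.subgradient hγ hRbot hRconvex (hq.ne_top hz)
  have h₂ := hq.subgradient hγ hRbot hRconvex (hp.ne_top hz)
  have hexpand : ⟪x - p, q - p⟫ + ⟪y - q, p - q⟫ = ‖p - q‖ ^ 2 - ⟪x - y, p - q⟫ := by
    rw [← real_inner_self_eq_norm_sq, ← neg_sub p q, inner_neg_right, neg_add_eq_sub,
      ← inner_sub_left, ← inner_sub_left]
    congr 1
    abel
  have hcs := real_inner_le_norm (x - y) (p - q)
  have hsq : ‖p - q‖ * ‖p - q‖ ≤ ‖x - y‖ * ‖p - q‖ := by linarith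
  rcases (norm_nonneg (p - q)).eq_or_lt with h0 | h0
  · rw [← h0]
    positivity
  · exact le_of_mul_le_mul_right hsq h0

end Proximal

section ProximalGradient

variable {E : Type*} [NormedAddCommGroup E] [InnerProductSpace ℝ E] [CompleteSpace E]

/-- Change of the objective over a proximal gradient step from `s` to `p`, measured from an
arbitrary point `y`. -/
theorem IsProxPoint.objective_sub_le {D : E → ℝ} {g : E → E} {L : ℝ} {R : E → EReal} {γ : ℝ}
    {s p y : E} (hD : ∀ x, HasGradientAt D (g x) x) (hg : ∀ x y, ‖g x - g y‖ ≤ L * ‖x - y‖)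
    (hp : IsProxPoint R γ (s - γ • g s) p) (hγ : 0 < γ) (hRbot : ∀ x, R x ≠ ⊥)
    (hRconvex : ∀ x y : E, ∀ a b : ℝ, 0 ≤ a → 0 ≤ b → a + b = 1 →
      R (a • x + b • y) ≤ (a : EReal) * R x + (b : EReal) * R y)
    (hy : R y ≠ ⊤) :
    2 * γ * ((D p + (R p).toReal) - (D y + (R y).toReal)) ≤
      (1 + γ * L) * ‖s - y‖ ^ 2 - (1 - γ * L) * ‖p - s‖ ^ 2 - ‖p - y‖ ^ 2 := by
  have hR := hp.subgradient hγ hRbot hRconvex hy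
  have hup := mul_le_mul_of_nonneg_left (le_quadratic_of_lipschitz_gradient hD hg s p) hγ.le
  have hlow := mul_le_mul_of_nonneg_left (quadratic_le_of_lipschitz_gradient hD hg s y) hγ.le
  have hinner : ⟪s - γ • g s - p, y - p⟫ = ⟪s - p, y - p⟫ - γ * (⟪g s, y - s⟫ - ⟪g s, p - s⟫) := by
    rw [← inner_sub_right, sub_sub_sub_cancel_right, sub_right_comm s, inner_sub_left,
      real_inner_smul_left]
  have hpolar := norm_sub_sq_real (s - p) (y - p)
  rw [sub_sub_sub_cancel_right, norm_sub_rev s p, norm_sub_rev y p] at hpolar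
  rw [norm_sub_rev y s] at hlow
  linarith

end ProximalGradient

theorem fista_momentum_mem_Icc {t : ℕ → ℝ} (ht0 : t 0 = 1)
    (htrec : ∀ k, t (k + 1) = (Real.sqrt (4 * t k ^ 2 + 1) + 1) / 2) (k : ℕ) :
    (t k - 1) / t (k + 1) ∈ Set.Icc (0 : ℝ) 1 := by
  have hone : 1 ≤ t k := by
    induction k with
    | zero => exact ht0.ge
    | succ k ih =>
      rw [htrec]
      have : 1 ≤ Real.sqrt (4 * t k ^ 2 + 1) := Real.one_le_sqrt.2 (by nlinarith)
      linarith
  have hmono : t k ≤ t (k + 1) := by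
    have : 2 * t k ≤ Real.sqrt (4 * t k ^ 2 + 1) := Real.le_sqrt_of_sq_le (by nlinarith)
    rw [htrec]
    linarith
  exact ⟨div_nonneg (by linarith) (by linarith), (div_le_one (by linarith)).2 (by linarith)⟩

/-- Proposition 3, part (ii): convergence rate of relaxed FISTA. With step size
`0 < γ ≤ (1 - α²)/(2L)` and `F* = inf F > -∞`, for every `K ≥ 1`,
`min_{k∈{1,…,K}} ‖G_γ(f_k)‖² ≤ 2L(3 + γL)²(F(f₀) - F*)/(K γ L (1 - γL))`. -/
theorem stmt19 (N : ℕ)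
    (D : EuclideanSpace ℝ (Fin N) → ℝ)
    (gradD : EuclideanSpace ℝ (Fin N) → EuclideanSpace ℝ (Fin N))
    (hdiff : ∀ x, HasGradientAt D (gradD x) x)
    (L : ℝ) (hL : 0 < L) (hLip : ∀ x y, ‖gradD x - gradD y‖ ≤ L * ‖x - y‖)
    (R : EuclideanSpace ℝ (Fin N) → EReal)
    (hRproper : ∃ x, R x ≠ ⊤) (hRbot : ∀ x, R x ≠ ⊥)
    (hRconvex : ∀ x y : EuclideanSpace ℝ (Fin N), ∀ a b : ℝ, 0 ≤ a → 0 ≤ b → a + b = 1 →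
      R (a • x + b • y) ≤ (a : EReal) * R x + (b : EReal) * R y)
    (hRlsc : LowerSemicontinuous R)
    (F : EuclideanSpace ℝ (Fin N) → EReal) (hF : ∀ x, F x = (D x : EReal) + R x)
    (γ α : ℝ) (hγ0 : 0 < γ) (hγ : γ ≤ (1 - α ^ 2) / (2 * L)) (hα0 : 0 ≤ α) (hα1 : α < 1)
    (prox : EuclideanSpace ℝ (Fin N) → EuclideanSpace ℝ (Fin N))
    -- `prox x` is the unique minimizer of `z ↦ R(z) + (1/(2γ))‖z - x‖²`
    (hprox : ∀ x p, p = prox x ↔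
      ∀ z, R p + ((1 / (2 * γ) * ‖p - x‖ ^ 2 : ℝ) : EReal) ≤
        R z + ((1 / (2 * γ) * ‖z - x‖ ^ 2 : ℝ) : EReal))
    (t : ℕ → ℝ) (ht0 : t 0 = 1)
    (htrec : ∀ k, t (k + 1) = (Real.sqrt (4 * t k ^ 2 + 1) + 1) / 2)
    (f s : ℕ → EuclideanSpace ℝ (Fin N))
    (hF0 : F (f 0) ≠ ⊤)
    (hs1 : s 1 = f 0)
    (hfk : ∀ k, 1 ≤ k → f k = prox (s k - γ • gradD (s k)))
    (hsk : ∀ k, 1 ≤ k → s (k + 1) = f k + (α * ((t k - 1) / t (k + 1))) • (f k - f (k - 1)))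
    (Fstar : EReal) (hFstar : Fstar = ⨅ x, F x) (hFstarBot : ⊥ < Fstar) :
    ∀ K : ℕ, ∀ hK : 1 ≤ K,
      (Finset.Icc 1 K).inf' (Finset.nonempty_Icc.mpr hK)
          (fun k => ‖gradMap γ gradD prox (f k)‖ ^ 2) ≤
        2 * L * (3 + γ * L) ^ 2 * (F (f 0) - Fstar).toReal
          / (K * γ * L * (1 - γ * L)) := by
  intro K hK
  have hγL : γ * L ≤ (1 - α ^ 2) / 2 := by
    rw [le_div_iff₀ (by positivity)] at hγ
    linarith
  have hγL0 : 0 < γ * L := mul_pos hγ0 hL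
  have hgap : 0 < 1 - γ * L := by nlinarith [sq_nonneg α]
  have hprox' (x) : IsProxPoint R γ x (prox x) := (hprox x _).1 rfl
  have hRf (k : ℕ) : R (f k) ≠ ⊤ := by
    rcases k.eq_zero_or_pos with rfl | hk
    · intro h
      exact hF0 (by rw [hF, h, EReal.coe_add_top])
    · rw [hfk k hk]
      exact (hprox' _).ne_top hRproper.choose_spec
  set Φ : ℕ → ℝ := fun k => D (f k) + (R (f k)).toReal with hΦ
  have hFΦ (k : ℕ) : F (f k) = (Φ k : EReal) := by
    rw [hF, hΦ, EReal.coe_add, EReal.coe_toReal (hRf k) (hRbot _)]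
  have hstar_le (k : ℕ) : Fstar ≤ (Φ k : EReal) := hFΦ k ▸ hFstar ▸ iInf_le F (f k)
  have hstar_top : Fstar ≠ ⊤ := ne_top_of_le_ne_top (EReal.coe_ne_top _) (hstar_le 0)
  lift Fstar to ℝ using ⟨hstar_top, hFstarBot.ne'⟩ with F'
  simp only [EReal.coe_le_coe_iff] at hstar_le
  have hstep (k : ℕ) (hk : 1 ≤ k) : 2 * γ * (Φ k - Φ (k - 1)) ≤
      (1 + γ * L) * ‖s k - f (k - 1)‖ ^ 2 - (1 - γ * L) * ‖f k - s k‖ ^ 2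
        - ‖f k - f (k - 1)‖ ^ 2 := by
    have hp := hprox' (s k - γ • gradD (s k))
    rw [← hfk k hk] at hp
    exact hp.objective_sub_le hdiff hLip hγ0 hRbot hRconvex (hRf _)
  have hextrap (k : ℕ) (hk : 1 ≤ k) :
      (1 + γ * L) * ‖s (k + 1) - f k‖ ^ 2 ≤ ‖f k - f (k - 1)‖ ^ 2 := by
    obtain ⟨hθ0, hθ1⟩ := fista_momentum_mem_Icc ht0 htrec k
    rw [hsk k hk, add_sub_cancel_left, norm_smul, mul_pow, Real.norm_eq_abs, sq_abs, ← mul_assoc]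
    refine mul_le_of_le_one_left (by positivity) ?_
    have hθ : (α * ((t k - 1) / t (k + 1))) ^ 2 ≤ α ^ 2 := by
      gcongr
      exact mul_le_of_le_one_right hα0 hθ1
    have hα2 : α ^ 2 ≤ 1 := by nlinarith
    calc _ ≤ (1 + (1 - α ^ 2) / 2) * α ^ 2 := by gcongr
      _ ≤ 1 := by nlinarith
  have hsum (n : ℕ) : (1 - γ * L) * ∑ k ∈ Finset.Icc 1 (n + 1), ‖f k - s k‖ ^ 2
      + ‖f (n + 1) - f n‖ ^ 2 ≤ 2 * γ * (Φ 0 - Φ (n + 1)) := by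
    induction n with
    | zero =>
      have h := hstep 1 le_rfl
      simp only [hs1, Nat.sub_self, sub_self, norm_zero] at h
      simp only [zero_add, Finset.Icc_self, Finset.sum_singleton, hs1]
      linarith
    | succ n ih =>
      rw [Finset.sum_Icc_succ_top (by omega), mul_add]
      have h₁ := hstep (n + 1 + 1) (by omega)
      have h₂ := hextrap (n + 1) (by omega)
      simp only [Nat.add_sub_cancel] at h₁ h₂
      linarith
  have hgrad (k : ℕ) (hk : k ∈ Finset.Icc 1 K) :
      ‖gradMap γ gradD prox (f k)‖ ^ 2 ≤ ((1 + γ * L) / γ) ^ 2 * ‖f k - s k‖ ^ 2 := by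
    rw [← mul_pow]
    have hp := hprox' (s k - γ • gradD (s k))
    rw [← hfk k (Finset.mem_Icc.1 hk).1] at hp
    have hnonexp := hp.norm_sub_le (hprox' (f k - γ • gradD (f k))) hγ0 hRbot hRconvex hRproper
    have hforward : ‖s k - γ • gradD (s k) - (f k - γ • gradD (f k))‖ ≤
        (1 + γ * L) * ‖f k - s k‖ := by
      rw [sub_sub_sub_comm, ← smul_sub]
      refine (norm_sub_le _ _).trans ?_
      rw [norm_smul, Real.norm_of_nonneg hγ0.le, norm_sub_rev (f k)]
      linarith [mul_le_mul_of_nonneg_left (hLip (s k) (f k)) hγ0.le]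
    gcongr
    rw [gradMap, norm_smul, norm_inv, Real.norm_of_nonneg hγ0.le, div_mul_eq_mul_div,
      div_eq_inv_mul]
    gcongr
    exact hnonexp.trans hforward
  have hΔ : (F (f 0) - (F' : EReal)).toReal = Φ 0 - F' := by
    rw [hFΦ, ← EReal.coe_sub, EReal.toReal_coe]
  have hΔ0 : 0 ≤ Φ 0 - F' := sub_nonneg.2 (hstar_le 0)
  have htotal : (1 - γ * L) * ∑ k ∈ Finset.Icc 1 K, ‖f k - s k‖ ^ 2 ≤ 2 * γ * (Φ 0 - F') := by
    obtain ⟨n, rfl⟩ := Nat.exists_eq_add_of_le' hK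
    have h := mul_le_mul_of_nonneg_left (hstar_le (n + 1)) (by positivity : 0 ≤ 2 * γ)
    linarith [hsum n, sq_nonneg ‖f (n + 1) - f n‖]
  set m := (Finset.Icc 1 K).inf' (Finset.nonempty_Icc.mpr hK)
    (fun k => ‖gradMap γ gradD prox (f k)‖ ^ 2)
  have hmin : K * m ≤ ((1 + γ * L) / γ) ^ 2 * ∑ k ∈ Finset.Icc 1 K, ‖f k - s k‖ ^ 2 := by
    have h := Finset.card_nsmul_le_sum (Finset.Icc 1 K) _ m fun k hk =>
      (Finset.inf'_le _ hk).trans (hgrad k hk)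
    rwa [Nat.card_Icc, Nat.add_sub_cancel, nsmul_eq_mul, ← Finset.mul_sum] at h
  have hK0 : (0 : ℝ) < K := by exact_mod_cast hK
  rw [hΔ, le_div_iff₀ (by positivity)]
  calc m * (K * γ * L * (1 - γ * L)) = γ * L * (1 - γ * L) * (K * m) := by ring
    _ ≤ γ * L * (1 - γ * L) *
        (((1 + γ * L) / γ) ^ 2 * ∑ k ∈ Finset.Icc 1 K, ‖f k - s k‖ ^ 2) := by gcongr
    _ = γ * L * ((1 + γ * L) / γ) ^ 2 *
        ((1 - γ * L) * ∑ k ∈ Finset.Icc 1 K, ‖f k - s k‖ ^ 2) := by ring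
    _ ≤ γ * L * ((1 + γ * L) / γ) ^ 2 * (2 * γ * (Φ 0 - F')) := by gcongr
    _ = 2 * L * (1 + γ * L) ^ 2 * (Φ 0 - F') := by field_simp
    _ ≤ 2 * L * (3 + γ * L) ^ 2 * (Φ 0 - F') := by gcongr; norm_num
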